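/- Let t ≥ 4 and 2 ≤ s ≤ t. There exists n₀ such that for all n ≥ n₀ the following holds: with G⋆ and K as in the extremal setup, G⋆ − K has at most one connected component whose number of vertices lies in {1, 2, …, t−1} ∪ {t+2}. -/

import Mathlib

open SimpleGraph

/-- `H` is a minor of `G` (branch-set definition). -/
def MinorOf {α β : Type} (H : SimpleGraph α) (G : SimpleGraph β) : Prop :=
  ∃ φ : α → Set β,
    (∀ a, (G.induce (φ a)).Connected) ∧
    (Pairwise fun a b => Disjoint (φ a) (φ b)) ∧
    (∀ a b, H.Adj a b → ∃ x ∈ φ a, ∃ y ∈ φ b, G.Adj x y)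

/-- Adjacency matrix over ℝ. -/
noncomputable def adjMat {V : Type} [Fintype V] (G : SimpleGraph V) : Matrix V V ℝ :=
  letI := Classical.decRel G.Adj
  SimpleGraph.adjMatrix ℝ G

theorem adjMat_herm {V : Type} [Fintype V] (G : SimpleGraph V) : (adjMat G).IsHermitian := by
  letI := Classical.decRel G.Adj
  ext i j
  simp [adjMat, Matrix.conjTranspose_apply, SimpleGraph.adjMatrix_apply, SimpleGraph.adj_comm]

/-- Spectral radius = largest adjacency eigenvalue. -/
noncomputable def specRad {V : Type} [Fintype V] [DecidableEq V] (G : SimpleGraph V) : ℝ :=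
  ⨆ i, (adjMat_herm G).eigenvalues i

/-- degree -/
noncomputable def deg {V : Type} (G : SimpleGraph V) (v : V) : ℕ := (G.neighborSet v).ncard

/-- number of edges -/
noncomputable def ecard {V : Type} (G : SimpleGraph V) : ℕ := G.edgeSet.ncard

/-- k disjoint copies of G -/
def copies (k : ℕ) {V : Type} (G : SimpleGraph V) : SimpleGraph (Fin k × V) :=
  SimpleGraph.fromRel fun x y => x.1 = y.1 ∧ G.Adj x.2 y.2

/-- disjoint union -/
def gUnion {V W : Type} (G : SimpleGraph V) (H : SimpleGraph W) : SimpleGraph (V ⊕ W) :=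
  SimpleGraph.fromRel fun x y =>
    (∃ a b, x = Sum.inl a ∧ y = Sum.inl b ∧ G.Adj a b) ∨
    (∃ a b, x = Sum.inr a ∧ y = Sum.inr b ∧ H.Adj a b)

/-- join -/
def gJoin {V W : Type} (G : SimpleGraph V) (H : SimpleGraph W) : SimpleGraph (V ⊕ W) :=
  SimpleGraph.fromRel fun x y =>
    (∃ a b, x = Sum.inl a ∧ y = Sum.inl b ∧ G.Adj a b) ∨
    (∃ a b, x = Sum.inr a ∧ y = Sum.inr b ∧ H.Adj a b) ∨
    (∃ a b, x = Sum.inl a ∧ y = Sum.inr b)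

/-- Petersen graph (Kneser graph K(5,2)). -/
def petersen : SimpleGraph {s : Finset (Fin 5) // s.card = 2} :=
  SimpleGraph.fromRel fun a b => Disjoint a.1 b.1

/-- star K_{1,m} -/
def starG (m : ℕ) : SimpleGraph (Fin 1 ⊕ Fin m) := completeBipartiteGraph (Fin 1) (Fin m)

/-- the star forest H_{s,t} -/
def Hst (s t : ℕ) :
    SimpleGraph ((Fin ((t+1)/(s+1) - 1) × (Fin 1 ⊕ Fin s)) ⊕ (Fin 1 ⊕ Fin (t - ((t+1)/(s+1) - 1) * (s+1)))) :=
  gUnion (copies ((t+1)/(s+1) - 1) (starG s)) (starG (t - ((t+1)/(s+1) - 1) * (s+1)))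

/-- subdivide the edge uv of G by a path through k new vertices -/
def subdividePath {V : Type} (G : SimpleGraph V) (u v : V) (k : ℕ) : SimpleGraph (V ⊕ Fin k) :=
  SimpleGraph.fromRel fun x y =>
    (∃ a b, x = Sum.inl a ∧ y = Sum.inl b ∧ G.Adj a b ∧ ¬(a = u ∧ b = v) ∧ ¬(a = v ∧ b = u)) ∨
    (∃ i : Fin k, x = Sum.inl u ∧ y = Sum.inr i ∧ (i : ℕ) = 0) ∨
    (∃ i j : Fin k, x = Sum.inr i ∧ y = Sum.inr j ∧ (j : ℕ) = (i : ℕ) + 1) ∨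
    (∃ i : Fin k, x = Sum.inr i ∧ y = Sum.inl v ∧ (i : ℕ) = k - 1)

/-- (s,t)-property -/
def HasSTProp (s t : ℕ) {V : Type} (G : SimpleGraph V) : Prop :=
  ∀ a b : ℕ, 1 ≤ a → 1 ≤ b → a + b = t + 1 → a ≤ min s ((t+1)/2) →
    ¬ MinorOf (completeBipartiteGraph (Fin a) (Fin b)) G

/-- H_{a,b,c} -/
def Habc (a b c : ℕ) : SimpleGraph (Fin 3 ⊕ (Fin a ⊕ Fin b ⊕ Fin c)) :=
  SimpleGraph.fromRel fun x y =>
    (x = Sum.inl 0 ∧ y = Sum.inl 1) ∨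
    (x = Sum.inl 0 ∧ ∃ i : Fin a, y = Sum.inr (Sum.inl i)) ∨
    (x = Sum.inl 0 ∧ ∃ i : Fin b, y = Sum.inr (Sum.inr (Sum.inl i))) ∨
    (x = Sum.inl 1 ∧ ∃ i : Fin a, y = Sum.inr (Sum.inl i)) ∨
    (x = Sum.inl 1 ∧ ∃ i : Fin c, y = Sum.inr (Sum.inr (Sum.inr i))) ∨
    (x = Sum.inl 2 ∧ ∃ i : Fin b, y = Sum.inr (Sum.inr (Sum.inl i))) ∨
    (x = Sum.inl 2 ∧ ∃ i : Fin c, y = Sum.inr (Sum.inr (Sum.inr i)))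

noncomputable def edgeDegSum {V : Type} (G H : SimpleGraph V) : ℕ :=
  ∑ᶠ e ∈ G.edgeSet, Sym2.lift ⟨fun u v => deg H u + deg H v, fun u v => by dsimp; ring⟩ e


/-! ### Spectral part -/

lemma specRad_psd {n : ℕ} (G : SimpleGraph (Fin n)) :
    ((specRad G) • (1 : Matrix (Fin n) (Fin n) ℝ) - adjMat G).PosSemidef := by
  have h := adjMat_herm G
  have hle : ∀ i, h.eigenvalues i ≤ specRad G := fun i =>
    le_ciSup (f := fun i => h.eigenvalues i) (Set.finite_range _).bddAbove i
  set U : Matrix (Fin n) (Fin n) ℝ := (h.eigenvectorUnitary : Matrix (Fin n) (Fin n) ℝ) with hU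
  have hUU : U * U.conjTranspose = 1 := by
    have := (Matrix.mem_unitaryGroup_iff).1 h.eigenvectorUnitary.2
    simpa [Matrix.star_eq_conjTranspose] using this
  have hA : adjMat G = U * Matrix.diagonal h.eigenvalues * U.conjTranspose := by
    have := h.spectral_theorem
    rw [Unitary.conjStarAlgAut_apply] at this
    rw [Matrix.star_eq_conjTranspose] at this
    simpa [Function.comp_def] using this
  have hD : (Matrix.diagonal (fun i => specRad G - h.eigenvalues i)).PosSemidef := by
    apply Matrix.PosSemidef.diagonal
    intro i
    have := hle i
    simp only [Pi.zero_apply]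
    linarith
  have := hD.mul_mul_conjTranspose_same U
  convert this using 1
  have h1 : Matrix.diagonal (fun i => specRad G - h.eigenvalues i)
      = specRad G • (1 : Matrix (Fin n) (Fin n) ℝ) - Matrix.diagonal h.eigenvalues := by
    ext i j
    by_cases hij : i = j <;> simp [hij]
  rw [h1, Matrix.mul_sub, Matrix.sub_mul, ← hA, Matrix.mul_smul, Matrix.mul_one, Matrix.smul_mul, hUU]

lemma rayleigh_le {n : ℕ} (G : SimpleGraph (Fin n)) (x : Fin n → ℝ) :
    x ⬝ᵥ (adjMat G).mulVec x ≤ specRad G * (x ⬝ᵥ x) := by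
  have := (specRad_psd G).dotProduct_mulVec_nonneg x
  rw [Matrix.sub_mulVec, dotProduct_sub, Matrix.smul_mulVec] at this
  simp at this
  linarith

lemma adjMat_nonneg {n : ℕ} (G : SimpleGraph (Fin n)) (i j) : 0 ≤ adjMat G i j := by
  classical
  simp only [adjMat, SimpleGraph.adjMatrix_apply]
  split_ifs <;> norm_num

lemma exists_perron {n : ℕ} (hn : 0 < n) (G : SimpleGraph (Fin n)) :
    ∃ x : Fin n → ℝ, (∀ i, 0 ≤ x i) ∧ x ≠ 0 ∧ (adjMat G).mulVec x = specRad G • x := by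
  have h := adjMat_herm G
  have : Nonempty (Fin n) := ⟨⟨0, hn⟩⟩
  obtain ⟨i0, hi0⟩ := exists_eq_ciSup_of_finite (f := fun i => h.eigenvalues i)
  have hi0' : h.eigenvalues i0 = specRad G := hi0
  set y : Fin n → ℝ := (h.eigenvectorBasis i0).ofLp with hy
  have hAy : (adjMat G).mulVec y = specRad G • y := by
    rw [← hi0']; exact h.mulVec_eigenvectorBasis i0
  have hy0 : y ≠ 0 := by
    intro h0
    apply h.eigenvectorBasis.orthonormal.ne_zero i0
    ext i
    exact congrFun h0 i
  refine ⟨fun i => |y i|, fun i => abs_nonneg _, ?_, ?_⟩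
  · intro h0
    apply hy0
    ext i
    simpa using congrFun h0 i
  set x : Fin n → ℝ := fun i => |y i| with hx
  have hxx : x ⬝ᵥ x = y ⬝ᵥ y := by simp [dotProduct, hx]
  have h1 : y ⬝ᵥ (adjMat G).mulVec y ≤ x ⬝ᵥ (adjMat G).mulVec x := by
    simp only [dotProduct, Matrix.mulVec, Finset.mul_sum]
    refine Finset.sum_le_sum fun i _ => Finset.sum_le_sum fun j _ => ?_
    have : |y i * (adjMat G i j * y j)| = x i * (adjMat G i j * x j) := by
      rw [abs_mul, abs_mul, abs_of_nonneg (adjMat_nonneg G i j)]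
    rw [← this]; exact le_abs_self _
  have h2 : x ⬝ᵥ (adjMat G).mulVec x = specRad G * (x ⬝ᵥ x) := by
    apply le_antisymm (rayleigh_le G x)
    rw [hAy] at h1
    rw [hxx]
    simpa using h1
  have h3 := ((specRad_psd G).dotProduct_mulVec_zero_iff x).1 (by
    rw [Matrix.sub_mulVec, dotProduct_sub, Matrix.smul_mulVec]
    simp
    linarith)
  rw [Matrix.sub_mulVec, Matrix.smul_mulVec, Matrix.one_mulVec, sub_eq_zero] at h3
  exact h3.symm

open Classical in
lemma adjMat_app {n : ℕ} (G : SimpleGraph (Fin n)) (i j) :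
    adjMat G i j = if G.Adj i j then 1 else 0 := by
  simp only [adjMat, SimpleGraph.adjMatrix_apply]

set_option maxHeartbeats 1000000 in
open Classical in
/-- Adding edges inside a bounded set outside the dominating clique increases the spectral radius. -/
lemma spec_increase {s t n P : ℕ} (hs : 2 ≤ s) (ht : 1 ≤ t) (hn : (2 * (P + 1) * t) ^ 2 + s ≤ n)
    (G G' : SimpleGraph (Fin n)) (K S : Finset (Fin n)) (hK : K.card = s - 1)
    (hcl : G.IsClique (↑K : Set (Fin n))) (hdom : ∀ v : Fin n, v ∉ K → ∀ u ∈ K, G.Adj u v)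
    (hSK : ∀ v ∈ S, v ∉ K)
    (hdeg : ∀ v, v ∉ K → (Finset.univ.filter (fun w => w ∉ K ∧ G.Adj v w)).card ≤ t)
    (hGG : ∀ u v, ¬ (u ∈ S ∧ v ∈ S) → (G'.Adj u v ↔ G.Adj u v))
    (hP : ((S ×ˢ S).filter (fun p => G.Adj p.1 p.2)).card ≤ P)
    (hlt : ((S ×ˢ S).filter (fun p => G.Adj p.1 p.2)).card
      < ((S ×ˢ S).filter (fun p => G'.Adj p.1 p.2)).card) :
    specRad G < specRad G' := by
  have hn0 : 0 < n := by omega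
  obtain ⟨x, hx0, hxne, hx⟩ := exists_perron hn0 G
  set ρ := specRad G with hρ
  have heq : ∀ v, ∑ w, (if G.Adj v w then x w else 0) = ρ * x v := by
    intro v
    have := congrFun hx v
    simp only [Matrix.mulVec, dotProduct, adjMat_app, Pi.smul_apply, smul_eq_mul] at this
    rw [← this]
    refine Finset.sum_congr rfl fun w _ => ?_
    split_ifs <;> simp
  set T := ∑ w, x w with hT
  have hTpos : 0 < T := by
    obtain ⟨i, hi⟩ : ∃ i, x i ≠ 0 := by
      by_contra h
      push Not at h
      exact hxne (funext h)
    exact Finset.sum_pos' (fun i _ => hx0 i) ⟨i, Finset.mem_univ _, lt_of_le_of_ne (hx0 i) (Ne.symm hi)⟩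
  have hKadj : ∀ u ∈ K, ∀ w, G.Adj u w ↔ u ≠ w := by
    intro u hu w
    refine ⟨fun h => h.ne, fun h => ?_⟩
    by_cases hw : w ∈ K
    · exact hcl (by simpa using hu) (by simpa using hw) h
    · exact hdom w hw u hu
  have hKx : ∀ u ∈ K, (ρ + 1) * x u = T := by
    intro u hu
    have h1 := heq u
    have h2 : T = (∑ w, (if G.Adj u w then x w else 0)) + x u := by
      have : x u = ∑ w, (if u = w then x w else 0) := by simp
      rw [this, ← Finset.sum_add_distrib]
      refine Finset.sum_congr rfl fun w _ => ?_
      by_cases h : u = w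
      · subst h; simp
      · simp [hKadj u hu, h]
    rw [h2, h1]; ring
  have hρ0 : 0 ≤ ρ := by
    obtain ⟨i, hi⟩ : ∃ i, x i ≠ 0 := by
      by_contra h
      push Not at h
      exact hxne (funext h)
    have hi' : 0 < x i := lt_of_le_of_ne (hx0 i) (Ne.symm hi)
    have : 0 ≤ ρ * x i := by
      rw [← heq i]
      exact Finset.sum_nonneg fun w _ => by split_ifs <;> simp [hx0]
    exact nonneg_of_mul_nonneg_left this hi'
  set c := T / (ρ + 1) with hc
  have hcpos : 0 < c := by positivity
  have hKc : ∀ u ∈ K, x u = c := by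
    intro u hu
    rw [hc, eq_div_iff (by positivity), ← hKx u hu]; ring
  set b := ((s : ℝ) - 1) * c with hb
  have hs' : (2 : ℝ) ≤ s := by exact_mod_cast hs
  have hbc : c ≤ b := by rw [hb]; nlinarith
  have hbpos : 0 < b := by linarith
  have hsumK : ∑ w ∈ K, x w = b := by
    rw [Finset.sum_congr rfl hKc, Finset.sum_const, hK, nsmul_eq_mul, Nat.cast_sub (by omega)]
    simp [hb]
  have hL : ∀ v, v ∉ K → ρ * x v =
      b + ∑ w ∈ Finset.univ.filter (fun w => w ∉ K ∧ G.Adj v w), x w := by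
    intro v hv
    rw [← heq v, ← hsumK, ← Finset.sum_filter]
    have : Finset.univ.filter (fun w => G.Adj v w)
        = K ∪ Finset.univ.filter (fun w => w ∉ K ∧ G.Adj v w) := by
      ext w
      simp only [Finset.mem_filter, Finset.mem_univ, true_and, Finset.mem_union]
      by_cases hw : w ∈ K
      · simp [hw, (hdom v hv w hw).symm]
      · simp [hw]
    rw [this, Finset.sum_union]
    rw [Finset.disjoint_left]
    intro w hw hw'
    simp at hw'
    exact hw'.1 hw
  have hlow : ∀ v, v ∉ K → b ≤ ρ * x v := by
    intro v hv
    rw [hL v hv]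
    have : 0 ≤ ∑ w ∈ Finset.univ.filter (fun w => w ∉ K ∧ G.Adj v w), x w :=
      Finset.sum_nonneg fun w _ => hx0 w
    linarith
  have hρsq : ((2 * (P + 1) * t : ℕ) : ℝ) ^ 2 ≤ ρ ^ 2 := by
    have h1 : ρ * T = ρ * b + ∑ v ∈ Kᶜ, ρ * x v := by
      rw [← hsumK, ← Finset.mul_sum, ← mul_add, Finset.sum_add_sum_compl]
    have h2 : (Kᶜ.card : ℝ) * b ≤ ∑ v ∈ Kᶜ, ρ * x v := by
      rw [← nsmul_eq_mul]
      exact Finset.card_nsmul_le_sum _ _ _ fun v hv => hlow v (by simpa using hv)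
    have h3 : (2 * (P + 1) * t) ^ 2 ≤ Kᶜ.card := by
      rw [Finset.card_compl, hK, Fintype.card_fin]; omega
    have h3' : ((2 * (P + 1) * t : ℕ) : ℝ) ^ 2 ≤ (Kᶜ.card : ℝ) := by exact_mod_cast h3
    have h4 : T = (ρ + 1) * c := (mul_div_cancel₀ T (by positivity : ρ + 1 ≠ 0)).symm
    have h5 : (Kᶜ.card : ℝ) * c ≤ ρ ^ 2 * c := by
      have : (Kᶜ.card : ℝ) * c ≤ (Kᶜ.card : ℝ) * b :=
        mul_le_mul_of_nonneg_left hbc (Nat.cast_nonneg _)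
      have : ρ * c ≤ ρ * b := by gcongr
      rw [h4] at h1
      nlinarith
    exact h3'.trans (le_of_mul_le_mul_right h5 hcpos)
  have hρR : ((2 * (P + 1) * t : ℕ) : ℝ) ≤ ρ := by
    exact (sq_le_sq₀ (by positivity) hρ0).1 hρsq
  push_cast at hρR
  have ht' : (1 : ℝ) ≤ t := by exact_mod_cast ht
  have hP0 : (0 : ℝ) ≤ P := by positivity
  have hρt : 2 * (t : ℝ) ≤ ρ := by nlinarith [mul_nonneg hP0 (by linarith : (0:ℝ) ≤ t)]
  have hup : ∀ v, v ∉ K → (ρ - t) * x v ≤ b := by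
    intro v hv
    obtain ⟨m, hm, hmax⟩ := Finset.exists_max_image Kᶜ x ⟨v, by simpa using hv⟩
    have hm' : m ∉ K := by simpa using hm
    have h1 := hL m hm'
    have h2 : ∑ w ∈ Finset.univ.filter (fun w => w ∉ K ∧ G.Adj m w), x w ≤ t * x m := by
      calc _ ≤ ((Finset.univ.filter (fun w => w ∉ K ∧ G.Adj m w)).card : ℝ) * x m := by
            rw [← nsmul_eq_mul]
            refine Finset.sum_le_card_nsmul _ _ _ fun w hw => hmax w ?_
            simp at hw
            simpa using hw.1
        _ ≤ t * x m := by
            have : ((Finset.univ.filter (fun w => w ∉ K ∧ G.Adj m w)).card : ℝ) ≤ t := by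
              exact_mod_cast hdeg m hm'
            exact mul_le_mul_of_nonneg_right this (hx0 m)
    have h3 : x v ≤ x m := hmax v (by simpa using hv)
    nlinarith
  have hρpos : 0 < ρ := by linarith
  have hρtpos : 0 < ρ - t := by linarith
  set l := b / ρ with hl
  set h := b / (ρ - t) with hh
  have hlx : ∀ v, v ∉ K → l ≤ x v := by
    intro v hv
    rw [hl, div_le_iff₀ hρpos]; linarith [hlow v hv]
  have hhx : ∀ v, v ∉ K → x v ≤ h := by
    intro v hv
    rw [hh, le_div_iff₀ hρtpos]; linarith [hup v hv]
  have hlpos : 0 < l := by positivity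
  have hhpos : 0 < h := by positivity
  have key : ∀ F : SimpleGraph (Fin n), x ⬝ᵥ (adjMat F).mulVec x =
      ∑ p ∈ (S ×ˢ S).filter (fun p => F.Adj p.1 p.2), x p.1 * x p.2
      + ∑ p ∈ (S ×ˢ S)ᶜ, (if F.Adj p.1 p.2 then x p.1 * x p.2 else 0) := by
    intro F
    rw [Finset.sum_filter, Finset.sum_add_sum_compl, Fintype.sum_prod_type]
    simp only [dotProduct, Matrix.mulVec, Finset.mul_sum, adjMat_app]
    refine Finset.sum_congr rfl fun i _ => Finset.sum_congr rfl fun j _ => ?_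
    split_ifs <;> simp
  have hsame : ∑ p ∈ (S ×ˢ S)ᶜ, (if G'.Adj p.1 p.2 then x p.1 * x p.2 else 0)
      = ∑ p ∈ (S ×ˢ S)ᶜ, (if G.Adj p.1 p.2 then x p.1 * x p.2 else 0) := by
    refine Finset.sum_congr rfl fun p hp => ?_
    have := hGG p.1 p.2 (by simpa using hp)
    simp only [this]
  set p := ((S ×ˢ S).filter (fun p => G.Adj p.1 p.2)).card with hp
  set p' := ((S ×ˢ S).filter (fun p => G'.Adj p.1 p.2)).card with hp'
  have hA : ∑ p ∈ (S ×ˢ S).filter (fun p => G.Adj p.1 p.2), x p.1 * x p.2 ≤ p * h ^ 2 := by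
    rw [← nsmul_eq_mul]
    refine Finset.sum_le_card_nsmul _ _ _ fun q hq => ?_
    simp at hq
    rw [sq]
    exact mul_le_mul (hhx _ (hSK _ hq.1.1)) (hhx _ (hSK _ hq.1.2)) (hx0 _) hhpos.le
  have hA' : p' * l ^ 2 ≤ ∑ p ∈ (S ×ˢ S).filter (fun p => G'.Adj p.1 p.2), x p.1 * x p.2 := by
    rw [← nsmul_eq_mul]
    refine Finset.card_nsmul_le_sum _ _ _ fun q hq => ?_
    simp at hq
    rw [sq]
    exact mul_le_mul (hlx _ (hSK _ hq.1.1)) (hlx _ (hSK _ hq.1.2)) hlpos.le (hx0 _)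
  have hpp : (p : ℝ) * h ^ 2 < p' * l ^ 2 := by
    have h1 : (p : ℝ) + 1 ≤ p' := by exact_mod_cast hlt
    have h2 : (p : ℝ) ≤ P := by exact_mod_cast hP
    have h0 : (0 : ℝ) ≤ p := by positivity
    have h3 : (p : ℝ) * ρ ^ 2 < (p + 1) * (ρ - t) ^ 2 := by
      have h4 : 2 * ((p : ℝ) + 1) * t ≤ ρ := by
        refine le_trans ?_ hρR
        gcongr
      have h5 : 2 * ((p : ℝ) + 1) * t * ρ ≤ ρ * ρ := by gcongr
      have h6 : 0 < ((p : ℝ) + 1) * (t : ℝ) ^ 2 := by positivity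
      nlinarith
    calc (p : ℝ) * h ^ 2 = (p * ρ ^ 2) * (b ^ 2 / (ρ ^ 2 * (ρ - t) ^ 2)) := by
          rw [hh]; field_simp
      _ < ((p + 1) * (ρ - t) ^ 2) * (b ^ 2 / (ρ ^ 2 * (ρ - t) ^ 2)) := by
          gcongr
      _ = (p + 1) * l ^ 2 := by rw [hl]; field_simp
      _ ≤ p' * l ^ 2 := by gcongr
  have hfin : x ⬝ᵥ (adjMat G).mulVec x < x ⬝ᵥ (adjMat G').mulVec x := by
    rw [key G, key G', hsame]
    linarith
  have h1 : x ⬝ᵥ (adjMat G).mulVec x = ρ * (x ⬝ᵥ x) := by rw [hx]; simp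
  have h2 := rayleigh_le G' x
  have h3 : 0 < x ⬝ᵥ x := by
    have h0 : 0 ≤ x ⬝ᵥ x := by
      simp only [dotProduct]
      exact Finset.sum_nonneg fun i _ => mul_self_nonneg _
    refine lt_of_le_of_ne h0 fun h => hxne ?_
    exact (dotProduct_self_eq_zero).1 h.symm
  by_contra hcon
  push Not at hcon
  nlinarith

/-! ### Minors -/

lemma star_minor {s t n : ℕ} (hs : 1 ≤ s) (G : SimpleGraph (Fin n)) (K : Finset (Fin n))
    (hK : K.card = s - 1) (hdom : ∀ v : Fin n, v ∉ K → ∀ u ∈ K, G.Adj u v)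
    (U : Set (Fin n)) (hU : (G.induce U).Connected) (hUK : ∀ u ∈ U, u ∉ K)
    (B : Finset (Fin n)) (hB : t ≤ B.card) (hBK : ∀ b ∈ B, b ∉ K) (hBU : ∀ b ∈ B, b ∉ U)
    (hadj : ∀ b ∈ B, ∃ u ∈ U, G.Adj u b) :
    MinorOf (completeBipartiteGraph (Fin s) (Fin t)) G := by
  classical
  obtain ⟨B', hB'B, hB'⟩ := Finset.exists_subset_card_eq hB
  let ι : Fin (s - 1) ≃ K := (K.equivFinOfCardEq hK).symm
  let β : Fin t ≃ B' := (B'.equivFinOfCardEq hB').symm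
  have hβ : ∀ j, (β j : Fin n) ∈ B := fun j => hB'B (β j).2
  have hβinj : ∀ j j', (β j : Fin n) = β j' → j = j' := fun j j' h => β.injective (Subtype.ext h)
  have hιinj : ∀ j j', (ι j : Fin n) = ι j' → j = j' := fun j j' h => ι.injective (Subtype.ext h)
  let φ : Fin s ⊕ Fin t → Set (Fin n) := fun a => match a with
    | Sum.inl i => if h : i.1 < s - 1 then {(ι ⟨i.1, h⟩ : Fin n)} else U
    | Sum.inr j => {(β j : Fin n)}
  have hφ1 : ∀ (i : Fin s) (h : i.1 < s - 1), φ (Sum.inl i) = {(ι ⟨i.1, h⟩ : Fin n)} := by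
    intro i h; simp [φ, h]
  have hφ2 : ∀ (i : Fin s) (h : ¬ i.1 < s - 1), φ (Sum.inl i) = U := by
    intro i h; simp only [φ, h]; simp
  have hφ3 : ∀ j, φ (Sum.inr j) = {(β j : Fin n)} := fun j => rfl
  have hsing : ∀ v : Fin n, (G.induce ({v} : Set (Fin n))).Connected := by
    intro v
    have : Nonempty ({v} : Set (Fin n)) := ⟨⟨v, rfl⟩⟩
    refine SimpleGraph.Connected.mk ?_
    intro x y
    have : x = y := Subsingleton.elim _ _
    rw [this]
  have hLR : ∀ i j, Disjoint (φ (Sum.inl i)) (φ (Sum.inr j)) := by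
    intro i j
    rw [hφ3, Set.disjoint_singleton_right]
    by_cases h : i.1 < s - 1
    · rw [hφ1 i h]
      intro hh
      rw [Set.mem_singleton_iff] at hh
      exact hBK _ (hβ j) (hh ▸ (ι ⟨i.1, h⟩).2)
    · rw [hφ2 i h]
      exact hBU _ (hβ j)
  have hE : ∀ i j, ∃ x ∈ φ (Sum.inl i), ∃ y ∈ φ (Sum.inr j), G.Adj x y := by
    intro i j
    rw [hφ3]
    by_cases h : i.1 < s - 1
    · rw [hφ1 i h]
      exact ⟨_, rfl, _, rfl, hdom _ (hBK _ (hβ j)) _ (ι ⟨i.1, h⟩).2⟩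
    · rw [hφ2 i h]
      obtain ⟨u, hu, hub⟩ := hadj _ (hβ j)
      exact ⟨u, hu, _, rfl, hub⟩
  refine ⟨φ, ?_, ?_, ?_⟩
  · rintro (i | j)
    · by_cases h : i.1 < s - 1
      · rw [hφ1 i h]; exact hsing _
      · rw [hφ2 i h]; exact hU
    · rw [hφ3]; exact hsing _
  · rintro (i | j) (i' | j') hne
    · by_cases h : i.1 < s - 1 <;> by_cases h' : i'.1 < s - 1
      · rw [hφ1 i h, hφ1 i' h', Set.disjoint_singleton]
        intro hh
        have := hιinj _ _ hh
        simp at this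
        exact hne (by rw [Fin.ext this])
      · rw [hφ1 i h, hφ2 i' h', Set.disjoint_singleton_left]
        intro hh
        exact hUK _ hh (ι ⟨i.1, h⟩).2
      · rw [hφ2 i h, hφ1 i' h', Set.disjoint_singleton_right]
        intro hh
        exact hUK _ hh (ι ⟨i'.1, h'⟩).2
      · exact absurd (congrArg Sum.inl (Fin.ext (by have := i.2; have := i'.2; omega))) hne
    · exact hLR i j'
    · exact (hLR i' j).symm
    · rw [hφ3, hφ3, Set.disjoint_singleton]
      intro hh
      exact hne (by rw [hβinj _ _ hh])
  · rintro (i | j) (i' | j') hab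
    · simp at hab
    · exact hE i j'
    · obtain ⟨x, hx, y, hy, hxy⟩ := hE i' j
      exact ⟨y, hy, x, hx, hxy.symm⟩
    · simp at hab

lemma const_of_connected {V γ : Type} (F : SimpleGraph V) (A : Set V) (hA : (F.induce A).Connected)
    (g : V → γ) (hg : ∀ x ∈ A, ∀ y ∈ A, F.Adj x y → g x = g y) :
    ∀ x ∈ A, ∀ y ∈ A, g x = g y := by
  intro x hx y hy
  obtain ⟨w⟩ := hA.preconnected ⟨x, hx⟩ ⟨y, hy⟩
  have : ∀ (a b : A), (F.induce A).Walk a b → g a = g b := by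
    intro a b w
    induction w with
    | nil => rfl
    | cons h _ ih => exact (hg _ (Subtype.coe_prop _) _ (Subtype.coe_prop _) h).trans ih
  exact this _ _ w

lemma minor_transfer {s t n : ℕ} (hs : 1 ≤ s) (hst : s ≤ t) (G G' : SimpleGraph (Fin n))
    (K S : Finset (Fin n)) (f : Fin n → Fin 3)
    (hK : K.card = s - 1)
    (hcl : G.IsClique (↑K : Set (Fin n))) (hdom : ∀ v : Fin n, v ∉ K → ∀ u ∈ K, G.Adj u v)
    (hcross : ∀ u ∈ S, ∀ v, v ∉ S → v ∉ K → ¬ G.Adj u v)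
    (hGG : ∀ u v, ¬ (u ∈ S ∧ v ∈ S) → (G'.Adj u v ↔ G.Adj u v))
    (hSS : ∀ u ∈ S, ∀ v ∈ S, G'.Adj u v → f u = f v)
    (hf : ∀ i, (S.filter (fun v => f v = i)).card ≤ t)
    (hG : ¬ MinorOf (completeBipartiteGraph (Fin s) (Fin t)) G) :
    ¬ MinorOf (completeBipartiteGraph (Fin s) (Fin t)) G' := by
  classical
  rintro ⟨φ, hconn, hdisj, hadj⟩
  apply hG
  have hKadj : ∀ u ∈ K, ∀ w, u ≠ w → G.Adj u w := by
    intro u hu w h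
    by_cases hw : w ∈ K
    · exact hcl (by simpa using hu) (by simpa using hw) h
    · exact hdom w hw u hu
  have hne : ∀ a, ∃ x, x ∈ φ a := fun a => by
    obtain ⟨x⟩ := (hconn a).nonempty
    exact ⟨x, x.2⟩
  have heqof : ∀ a b x, x ∈ φ a → x ∈ φ b → a = b := by
    intro a b x ha hb
    by_contra h
    exact Set.disjoint_left.1 (hdisj h) ha hb
  let T : Finset (Fin s ⊕ Fin t) := Finset.univ.filter (fun a => ∃ x ∈ φ a, x ∈ K)
  have hT : ∀ a, a ∈ T ↔ ∃ x ∈ φ a, x ∈ K := by intro a; simp [T]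
  have hκ : ∀ a, ∃ x, x ∈ φ a ∧ (a ∈ T → x ∈ K) := by
    intro a
    by_cases h : a ∈ T
    · obtain ⟨x, hx, hxK⟩ := (hT a).1 h
      exact ⟨x, hx, fun _ => hxK⟩
    · obtain ⟨x, hx⟩ := hne a
      exact ⟨x, hx, fun h' => absurd h' h⟩
  choose κ hκ1 hκ2 using hκ
  have hκinj : Function.Injective κ := by
    intro a b h
    exact heqof a b (κ a) (hκ1 a) (h ▸ hκ1 b)
  have hTcard : T.card ≤ s - 1 := by
    rw [← hK]
    exact Finset.card_le_card_of_injOn κ (fun a ha => hκ2 a ha) hκinj.injOn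
  have hTc : ∀ a, a ∉ T → ∀ x ∈ φ a, x ∉ K := by
    intro a ha x hx hxK
    exact ha ((hT a).2 ⟨x, hx, hxK⟩)
  obtain ⟨i0, hi0⟩ : ∃ i : Fin s, Sum.inl i ∉ T := by
    by_contra h
    push Not at h
    have : (Finset.univ : Finset (Fin s)).card ≤ T.card :=
      Finset.card_le_card_of_injOn Sum.inl (fun i _ => h i) Sum.inl_injective.injOn
    simp at this
    omega
  obtain ⟨j0, hj0⟩ : ∃ j : Fin t, Sum.inr j ∉ T := by
    by_contra h
    push Not at h
    have : (Finset.univ : Finset (Fin t)).card ≤ T.card :=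
      Finset.card_le_card_of_injOn Sum.inr (fun i _ => h i) Sum.inr_injective.injOn
    simp at this
    omega
  let g : Fin n → Option (Fin 3) := fun v => if v ∈ S then some (f v) else none
  have hg : ∀ x y, x ∉ K → y ∉ K → G'.Adj x y → g x = g y := by
    intro x y hx hy hxy
    by_cases hxS : x ∈ S <;> by_cases hyS : y ∈ S
    · simp [g, hxS, hyS, hSS x hxS y hyS hxy]
    · exact absurd ((hGG x y (by tauto)).1 hxy) (hcross x hxS y hyS hy)
    · exact absurd ((hGG x y (by tauto)).1 hxy).symm (hcross y hyS x hxS hx)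
    · simp [g, hxS, hyS]
  have hgc : ∀ a, a ∉ T → ∀ x ∈ φ a, ∀ y ∈ φ a, g x = g y := by
    intro a ha
    exact const_of_connected G' (φ a) (hconn a) g
      (fun x hx y hy h => hg x y (hTc a ha x hx) (hTc a ha y hy) h)
  have hgadj : ∀ i j, Sum.inl i ∉ T → Sum.inr j ∉ T → g (κ (Sum.inl i)) = g (κ (Sum.inr j)) := by
    intro i j hi hj
    obtain ⟨x, hx, y, hy, hxy⟩ := hadj (Sum.inl i) (Sum.inr j) (by simp)
    rw [hgc _ hi _ (hκ1 _) x hx, hgc _ hj _ (hκ1 _) y hy]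
    exact hg x y (hTc _ hi x hx) (hTc _ hj y hy) hxy
  have hall : ∀ a, a ∉ T → ∀ x ∈ φ a, g x = g (κ (Sum.inl i0)) := by
    intro a ha x hx
    rw [hgc a ha x hx _ (hκ1 a)]
    rcases a with i | j
    · rw [hgadj i j0 ha hj0, hgadj i0 j0 hi0 hj0]
    · rw [hgadj i0 j hi0 ha]
  rcases hg0 : g (κ (Sum.inl i0)) with _ | c
  · -- all free branch sets avoid S
    have hnS : ∀ a, a ∉ T → ∀ x ∈ φ a, x ∉ S := by
      intro a ha x hx hxS
      have := hall a ha x hx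
      rw [hg0] at this
      simp [g, hxS] at this
    let ψ : Fin s ⊕ Fin t → Set (Fin n) := fun a => if a ∈ T then {κ a} else φ a
    have hψ1 : ∀ a, a ∈ T → ψ a = {κ a} := fun a h => by simp [ψ, h]
    have hψ2 : ∀ a, a ∉ T → ψ a = φ a := fun a h => by simp [ψ, h]
    have hψκ : ∀ a, κ a ∈ ψ a := by
      intro a
      by_cases h : a ∈ T
      · rw [hψ1 a h]; rfl
      · rw [hψ2 a h]; exact hκ1 a
    refine ⟨ψ, ?_, ?_, ?_⟩
    · intro a
      by_cases h : a ∈ T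
      · rw [hψ1 a h]
        have : Nonempty ({κ a} : Set (Fin n)) := ⟨⟨κ a, rfl⟩⟩
        refine SimpleGraph.Connected.mk ?_
        intro x y
        have : x = y := Subsingleton.elim _ _
        rw [this]
      · rw [hψ2 a h]
        have : G.induce (φ a) = G'.induce (φ a) := by
          ext x y
          simp only [SimpleGraph.comap_adj, Function.Embedding.subtype_apply]
          exact (hGG x y (fun hh => hnS a h x x.2 hh.1)).symm
        rw [this]
        exact hconn a
    · intro a b hab
      have hsub : ∀ a, ψ a ⊆ φ a := by
        intro a
        by_cases h : a ∈ T
        · rw [hψ1 a h]; exact Set.singleton_subset_iff.2 (hκ1 a)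
        · rw [hψ2 a h]
      exact (hdisj hab).mono (hsub a) (hsub b)
    · intro a b hab
      by_cases ha : a ∈ T
      · exact ⟨κ a, hψκ a, κ b, hψκ b, hKadj _ (hκ2 a ha) _ (fun h => hab.ne (hκinj h))⟩
      · by_cases hb : b ∈ T
        · exact ⟨κ a, hψκ a, κ b, hψκ b,
            (hKadj _ (hκ2 b hb) _ (fun h => hab.ne (hκinj h).symm)).symm⟩
        · rw [hψ2 a ha, hψ2 b hb]
          obtain ⟨x, hx, y, hy, hxy⟩ := hadj a b hab
          exact ⟨x, hx, y, hy, (hGG x y (fun hh => hnS a ha x hx hh.1)).1 hxy⟩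
  · exfalso
    have h1 : Tᶜ.card ≤ (S.filter (fun v => f v = c)).card := by
      refine Finset.card_le_card_of_injOn κ (fun a ha => ?_) hκinj.injOn
      have := hall a (by simpa using ha) (κ a) (hκ1 a)
      rw [hg0] at this
      by_cases h : κ a ∈ S
      · simp [g, h] at this
        simp [h, this]
      · simp [g, h] at this
    have h2 := hf c
    rw [Finset.card_compl] at h1
    simp at h1
    omega

/-! ### An Erdős–Rényi type bound on graphs of diameter two -/

lemma conn_count {V : Type} [Fintype V] [DecidableEq V] (F : SimpleGraph V) [DecidableRel F.Adj]
    (r : V) (P : Finset V) (hP : ∀ p ∈ P, F.Reachable r p) :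
    2 * P.card ≤ (∑ v, F.degree v) + 2 := by
  classical
  rw [F.sum_degrees_eq_twice_card_edges]
  set c := F.connectedComponentMk r
  have h1 := (c.connected_toSimpleGraph).card_vert_le_card_edgeSet_add_one
  have h2 : P.card ≤ Nat.card c := by
    have hmem : ∀ p : P, p.1 ∈ c := fun p =>
      (SimpleGraph.ConnectedComponent.mem_supp_iff _ _).2
        (SimpleGraph.ConnectedComponent.sound (hP p.1 p.2).symm)
    have := Nat.card_le_card_of_injective (fun p : P => (⟨p.1, hmem p⟩ : c))
      (fun p q h => Subtype.ext (congrArg (fun z : c => z.1) h))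
    simpa using this
  have h3 : Nat.card c.toSimpleGraph.edgeSet ≤ F.edgeFinset.card := by
    have := Nat.card_le_card_of_injective _
      ((SimpleGraph.Embedding.induce (G := F) c.supp).mapEdgeSet).injective
    rw [SimpleGraph.edgeFinset_card, ← Nat.card_eq_fintype_card]
    exact this
  omega

set_option linter.unusedSectionVars false

section ER

variable {V : Type} [Fintype V] [DecidableEq V] (H : SimpleGraph V) [DecidableRel H.Adj]

/-- number of ordered adjacent pairs between two sets -/
def ee (P Q : Finset V) : ℕ := ∑ u ∈ P, ∑ w ∈ Q, if H.Adj u w then 1 else 0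

lemma ee_comm (P Q : Finset V) : ee H P Q = ee H Q P := by
  unfold ee
  rw [Finset.sum_comm]
  simp only [H.adj_comm]

lemma ee_union_right (P Q R : Finset V) (h : Disjoint Q R) :
    ee H P (Q ∪ R) = ee H P Q + ee H P R := by
  unfold ee
  rw [← Finset.sum_add_distrib]
  refine Finset.sum_congr rfl fun u _ => Finset.sum_union h

lemma ee_union_left (P Q R : Finset V) (h : Disjoint Q R) :
    ee H (Q ∪ R) P = ee H Q P + ee H R P := by
  unfold ee
  exact Finset.sum_union h

lemma ee_univ (P : Finset V) : ee H P Finset.univ = ∑ u ∈ P, H.degree u := by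
  unfold ee
  refine Finset.sum_congr rfl fun u _ => ?_
  rw [← Finset.sum_filter, ← SimpleGraph.card_neighborFinset_eq_degree, Finset.card_eq_sum_ones,
    SimpleGraph.neighborFinset_eq_filter]

lemma one_le_row {u : V} {Q : Finset V} (h : ∃ w ∈ Q, H.Adj u w) :
    1 ≤ ∑ w ∈ Q, if H.Adj u w then 1 else 0 := by
  obtain ⟨w, hw, huw⟩ := h
  calc 1 = if H.Adj u w then 1 else 0 := by simp [huw]
    _ ≤ _ := Finset.single_le_sum (f := fun w => if H.Adj u w then 1 else 0) (fun _ _ => Nat.zero_le _) hw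

lemma card_le_ee {P Q : Finset V} (h : ∀ u ∈ P, ∃ w ∈ Q, H.Adj u w) : P.card ≤ ee H P Q := by
  unfold ee
  rw [Finset.card_eq_sum_ones]
  exact Finset.sum_le_sum fun u hu => one_le_row H (h u hu)

/-- the one-sided case -/
lemma er_aux (v a b : V) (W : Finset V) (hab : a ≠ b) (hva : H.Adj v a) (hvb : H.Adj v b)
    (hW : ∀ w, w ∈ W ↔ w ≠ v ∧ w ≠ a ∧ w ≠ b)
    (hvW : ∀ w ∈ W, ¬ H.Adj v w)
    (hdiam : ∀ u v, u ≠ v → ¬ H.Adj u v → ∃ w, H.Adj u w ∧ H.Adj v w)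
    (hdom : ∀ v, ∃ u, u ≠ v ∧ ¬ H.Adj v u)
    (hB : ∀ w ∈ W, H.Adj w a) :
    2 * (W.filter (fun w => ¬ (H.Adj w a ∧ H.Adj w b))).card ≤ ee H W W + 2 := by
  have hab' : ¬ H.Adj a b := by
    intro h
    obtain ⟨u, hu, hau⟩ := hdom a
    apply hau
    by_cases h1 : u = v
    · rw [h1]; exact hva.symm
    · by_cases h2 : u = b
      · rw [h2]; exact h
      · exact (hB u ((hW u).2 ⟨h1, hu, h2⟩)).symm
  set A := W.filter (fun w => ¬ (H.Adj w a ∧ H.Adj w b)) with hA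
  set D := W.filter (fun w => (H.Adj w a ∧ H.Adj w b)) with hD
  have hDA : D ∪ A = W := Finset.filter_union_filter_not_eq _ _
  have hdisj : Disjoint D A := Finset.disjoint_filter_filter_not _ _ _
  have h1 : A.card ≤ ee H A D := by
    apply card_le_ee
    intro x hx
    simp only [hA, Finset.mem_filter] at hx
    obtain ⟨hxW, hx2⟩ := hx
    have hxb : ¬ H.Adj x b := fun h => hx2 ⟨hB x hxW, h⟩
    obtain ⟨w, hxw, hbw⟩ := hdiam x b ((hW x).1 hxW).2.2 hxb
    have hwW : w ∈ W := by
      rw [hW]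
      refine ⟨?_, ?_, ?_⟩
      · rintro rfl; exact hvW x hxW hxw.symm
      · rintro rfl; exact hab' hbw.symm
      · rintro rfl; exact hbw.ne rfl
    exact ⟨w, by simp only [hD, Finset.mem_filter]; exact ⟨hwW, hB w hwW, hbw.symm⟩, hxw⟩
  have h2 : ee H W W = ee H D D + ee H A D + (ee H D A + ee H A A) := by
    rw [← hDA, ee_union_right H _ _ _ hdisj, ee_union_left H _ _ _ hdisj,
      ee_union_left H _ _ _ hdisj]
  have h3 := ee_comm H A D
  omega

lemma er_two (v a b : V) (W : Finset V) (hab : a ≠ b) (hva : H.Adj v a) (hvb : H.Adj v b)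
    (hW : ∀ w, w ∈ W ↔ w ≠ v ∧ w ≠ a ∧ w ≠ b)
    (hvW : ∀ w ∈ W, ¬ H.Adj v w)
    (hdiam : ∀ u v, u ≠ v → ¬ H.Adj u v → ∃ w, H.Adj u w ∧ H.Adj v w)
    (hdom : ∀ v, ∃ u, u ≠ v ∧ ¬ H.Adj v u) :
    2 * (W.filter (fun w => ¬ (H.Adj w a ∧ H.Adj w b))).card ≤ ee H W W + 2 := by
  by_cases hA : ∀ w ∈ W, H.Adj w a
  · exact er_aux H v a b W hab hva hvb hW hvW hdiam hdom hA
  by_cases hB : ∀ w ∈ W, H.Adj w b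
  · have := er_aux H v b a W hab.symm hvb hva (fun w => by rw [hW]; tauto) hvW hdiam hdom hB
    simpa only [and_comm] using this
  push Not at hA hB
  obtain ⟨y, hyW, hya⟩ := hA
  obtain ⟨x, hxW, hxb⟩ := hB
  have hab1 : ∀ w ∈ W, H.Adj w a ∨ H.Adj w b := by
    intro w hw
    obtain ⟨z, hz1, hz2⟩ := hdiam w v ((hW w).1 hw).1 (fun h => hvW w hw h.symm)
    have hzW : z ∉ W := fun h => hvW z h hz2
    rw [hW] at hzW
    by_cases h1 : z = a
    · left; exact h1 ▸ hz1
    · by_cases h2 : z = b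
      · right; exact h2 ▸ hz1
      · exact absurd ⟨hz2.ne.symm, h1, h2⟩ hzW
  let F : SimpleGraph V :=
    { Adj := fun u w => H.Adj u w ∧ u ∈ W ∧ w ∈ W
      symm := ⟨fun u w h => ⟨h.1.symm, h.2.2, h.2.1⟩⟩
      loopless := ⟨fun u h => h.1.ne rfl⟩ }
  have : DecidableRel F.Adj := fun u w => inferInstanceAs (Decidable (H.Adj u w ∧ u ∈ W ∧ w ∈ W))
  have hreach : ∀ p ∈ W, ∀ q ∈ W, ¬ H.Adj p b → ¬ H.Adj q a → F.Reachable p q := by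
    intro p hp q hq hpb hqa
    by_cases hpq : p = q
    · rw [hpq]
    by_cases hadj : H.Adj p q
    · exact SimpleGraph.Adj.reachable (G := F) ⟨hadj, hp, hq⟩
    obtain ⟨z, hz1, hz2⟩ := hdiam p q hpq hadj
    have hz : z ∈ W := by
      rw [hW]
      refine ⟨?_, ?_, ?_⟩
      · rintro rfl; exact hvW p hp hz1.symm
      · rintro rfl; exact hqa hz2
      · rintro rfl; exact hpb hz1
    exact (SimpleGraph.Adj.reachable (G := F) ⟨hz1, hp, hz⟩).trans
      (SimpleGraph.Adj.reachable (G := F) ⟨hz2.symm, hz, hq⟩)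
  have hxy := hreach x hxW y hyW hxb hya
  have h1 := conn_count F x (W.filter (fun w => ¬ (H.Adj w a ∧ H.Adj w b))) (by
    intro p hp
    simp only [Finset.mem_filter] at hp
    obtain ⟨hpW, hp2⟩ := hp
    by_cases hpa : H.Adj p a
    · have hpb : ¬ H.Adj p b := fun h => hp2 ⟨hpa, h⟩
      exact hxy.trans (hreach p hpW y hyW hpb hya).symm
    · exact hreach x hxW p hpW hxb hpa)
  have h2 : ∑ u, F.degree u = ee H W W := by
    rw [← ee_univ]
    unfold ee
    rw [← Finset.sum_filter_add_sum_filter_not (s := Finset.univ) (fun u => u ∈ W)]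
    have hz : ∑ u ∈ Finset.univ.filter (fun u => u ∉ W), ∑ w, (if F.Adj u w then 1 else 0) = 0 := by
      refine Finset.sum_eq_zero fun u hu => Finset.sum_eq_zero fun w _ => ?_
      simp only [Finset.mem_filter] at hu
      exact if_neg fun h => hu.2 h.2.1
    rw [hz, add_zero, Finset.filter_mem_eq_inter, Finset.univ_inter]
    refine Finset.sum_congr rfl fun u hu => ?_
    rw [← Finset.sum_filter_add_sum_filter_not (s := Finset.univ) (fun u => u ∈ W)]
    have hz : ∑ w ∈ Finset.univ.filter (fun u => u ∉ W), (if F.Adj u w then 1 else 0) = 0 := by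
      refine Finset.sum_eq_zero fun w hw => ?_
      simp only [Finset.mem_filter] at hw
      exact if_neg fun h => hw.2 h.2.2
    rw [hz, add_zero, Finset.filter_mem_eq_inter, Finset.univ_inter]
    refine Finset.sum_congr rfl fun w hw => ?_
    have : F.Adj u w ↔ H.Adj u w := ⟨fun h => h.1, fun h => ⟨h, hu, hw⟩⟩
    simp only [this]
  omega

lemma er_bound (hdeg : ∀ v, 2 ≤ H.degree v)
    (hdiam : ∀ u v, u ≠ v → ¬ H.Adj u v → ∃ w, H.Adj u w ∧ H.Adj v w)
    (hdom : ∀ v, ∃ u, u ≠ v ∧ ¬ H.Adj v u) :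
    4 * Fintype.card V ≤ (∑ v, H.degree v) + 10 := by
  by_cases h4 : ∀ v, 4 ≤ H.degree v
  · have : ∑ v : V, 4 ≤ ∑ v, H.degree v := Finset.sum_le_sum fun v _ => h4 v
    simp at this
    omega
  obtain ⟨v, hv, hmin⟩ : ∃ v, H.degree v ≤ 3 ∧ ∀ u, H.degree v ≤ H.degree u := by
    push Not at h4
    obtain ⟨v0, hv0⟩ := h4
    obtain ⟨v, _, hmin⟩ := Finset.exists_min_image Finset.univ (fun u => H.degree u) ⟨v0, Finset.mem_univ _⟩
    refine ⟨v, ?_, fun u => hmin u (Finset.mem_univ _)⟩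
    have := hmin v0 (Finset.mem_univ _)
    omega
  set N := H.neighborFinset v with hN
  set W := (insert v N)ᶜ with hW
  have hvN : v ∉ N := by simp [hN]
  have hNcard : N.card = H.degree v := H.card_neighborFinset_eq_degree v
  have hWmem : ∀ w, w ∈ W ↔ w ≠ v ∧ ¬ H.Adj v w := by
    intro w; simp [hW, hN]
  have hWcard : W.card + (H.degree v + 1) = Fintype.card V := by
    rw [hW, ← hNcard, ← Finset.card_insert_of_notMem hvN, Finset.card_compl_add_card]
  have hVN : Disjoint {v} N := by simpa using hvN
  have hVNW : Disjoint ({v} ∪ N) W := by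
    rw [hW, Finset.insert_eq]; exact disjoint_compl_right
  have huniv : (Finset.univ : Finset V) = ({v} ∪ N) ∪ W := by
    rw [hW, Finset.insert_eq, Finset.union_compl]
  have hrow : ∀ P, ee H P Finset.univ = ee H P {v} + ee H P N + ee H P W := by
    intro P
    rw [huniv, ee_union_right H _ _ _ hVNW, ee_union_right H _ _ _ hVN]
  have htot : ∑ u, H.degree u = ee H {v} Finset.univ + ee H N Finset.univ + ee H W Finset.univ := by
    rw [← ee_univ]
    conv_lhs => rw [huniv]
    rw [ee_union_left H _ _ _ hVNW, ee_union_left H _ _ _ hVN, ← huniv]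
  have hv1 : ee H {v} Finset.univ = H.degree v := by rw [ee_univ]; simp
  have hN1 : H.degree v ≤ ee H N {v} := by
    rw [← hNcard]
    apply card_le_ee
    intro u hu
    exact ⟨v, by simp, by simpa [hN, H.adj_comm] using hu⟩
  have hNW := ee_comm H N W
  have hN2 := hrow N
  have hWN : ∀ w ∈ W, ∃ z ∈ N, H.Adj w z := by
    intro w hw
    rw [hWmem] at hw
    obtain ⟨z, hz1, hz2⟩ := hdiam w v hw.1 (fun h => hw.2 h.symm)
    exact ⟨z, by simpa [hN] using hz2, hz1⟩
  have hWN' : W.card ≤ ee H W N := card_le_ee H hWN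
  by_cases h3 : H.degree v = 3
  · have h5 : W.card * 3 ≤ ee H W Finset.univ := by
      rw [ee_univ, ← smul_eq_mul]
      exact Finset.card_nsmul_le_sum _ _ _ fun w _ => h3 ▸ hmin w
    omega
  · have h2 : H.degree v = 2 := by have := hdeg v; omega
    obtain ⟨a, b, hab, hNab⟩ := Finset.card_eq_two.1 (hNcard.trans h2)
    have hva : H.Adj v a := by
      have : a ∈ N := by rw [hNab]; simp
      simpa [hN] using this
    have hvb : H.Adj v b := by
      have : b ∈ N := by rw [hNab]; simp
      simpa [hN] using this
    have hadjv : ∀ w, H.Adj v w ↔ w = a ∨ w = b := by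
      intro w
      have : w ∈ N ↔ H.Adj v w := by simp [hN]
      rw [← this, hNab]; simp
    have h6 := er_two H v a b W hab hva hvb (by intro w; rw [hWmem, hadjv]; tauto)
      (fun w hw => ((hWmem w).1 hw).2) hdiam hdom
    have h7 : 2 * W.card ≤ ee H W N + (W.filter (fun w => ¬ (H.Adj w a ∧ H.Adj w b))).card := by
      unfold ee
      rw [Finset.card_filter, ← Finset.sum_add_distrib, mul_comm, ← smul_eq_mul]
      refine Finset.card_nsmul_le_sum _ _ _ fun w hw => ?_
      have h8 := one_le_row H (hWN w hw)
      by_cases hc : H.Adj w a ∧ H.Adj w b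
      · rw [hNab, Finset.sum_pair hab]
        simp [hc.1, hc.2]
      · simp only [hc, not_false_eq_true, if_true]
        omega
    have h9 := hrow W
    omega

end ER

/-! ### Assembly -/

lemma card_pairs_eq_ee {V : Type} [Fintype V] [DecidableEq V] (H : SimpleGraph V)
    [DecidableRel H.Adj] (S : Finset V) :
    ((S ×ˢ S).filter (fun p => H.Adj p.1 p.2)).card = ee H S S := by
  unfold ee
  rw [Finset.card_filter, Finset.sum_product]

lemma ee_le_clique {V : Type} [Fintype V] [DecidableEq V] (H : SimpleGraph V)
    [DecidableRel H.Adj] (C : Finset V) : ee H C C + C.card ≤ C.card * C.card := by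
  have h : ((C ×ˢ C).filter (fun p => H.Adj p.1 p.2)) ⊆ C.offDiag := by
    intro p hp
    simp only [Finset.mem_filter, Finset.mem_product] at hp
    simp only [Finset.mem_offDiag]
    exact ⟨hp.1.1, hp.1.2, hp.2.ne⟩
  have h1 := Finset.card_le_card h
  rw [card_pairs_eq_ee, Finset.offDiag_card] at h1
  have := Nat.le_mul_self C.card
  omega

lemma deg_bound {s t n : ℕ} (hs : 1 ≤ s) (G : SimpleGraph (Fin n)) (K : Finset (Fin n))
    (hG : ¬ MinorOf (completeBipartiteGraph (Fin s) (Fin t)) G)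
    (hK : K.card = s - 1) (hdom : ∀ v : Fin n, v ∉ K → ∀ u ∈ K, G.Adj u v)
    (v : Fin n) (hv : v ∉ K) (B : Finset (Fin n)) (hB : ∀ b ∈ B, b ∉ K ∧ G.Adj v b) :
    B.card < t := by
  by_contra h
  push Not at h
  apply hG
  refine star_minor hs G K hK hdom {v} ?_ ?_ B h (fun b hb => (hB b hb).1) ?_ ?_
  · have : Nonempty ({v} : Set (Fin n)) := ⟨⟨v, rfl⟩⟩
    refine SimpleGraph.Connected.mk ?_
    intro x y
    have : x = y := Subsingleton.elim _ _
    rw [this]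
  · intro u hu
    rw [Set.mem_singleton_iff] at hu
    rwa [hu]
  · intro b hb hbv
    rw [Set.mem_singleton_iff] at hbv
    exact (hB b hb).2.ne hbv.symm
  · intro b hb
    exact ⟨v, rfl, (hB b hb).2⟩

open Classical in
lemma comp_bound {s t n : ℕ} (hs : 1 ≤ s) (G : SimpleGraph (Fin n)) (K : Finset (Fin n))
    (hG : ¬ MinorOf (completeBipartiteGraph (Fin s) (Fin t)) G)
    (hK : K.card = s - 1) (hdom : ∀ v : Fin n, v ∉ K → ∀ u ∈ K, G.Adj u v)
    (C : Finset (Fin n)) (hCK : ∀ v ∈ C, v ∉ K) (hC : C.card = t + 2)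
    (hiso : ∀ u ∈ C, ∃ w ∈ C, G.Adj u w) :
    ee G C C + t ≤ t * t + 4 := by
  let F : SimpleGraph C := G.comap Subtype.val
  have hF : ∀ x y : C, F.Adj x y ↔ G.Adj x y := fun x y => Iff.rfl
  have hcard : Fintype.card C = t + 2 := by simpa using hC
  have hFdeg : ∀ u, F.degree u + 1 ≤ t := by
    intro u
    have := deg_bound hs G K hG hK hdom u (hCK _ u.2)
      ((F.neighborFinset u).map (Function.Embedding.subtype _)) (by
        intro b hb
        simp only [Finset.mem_map, SimpleGraph.mem_neighborFinset] at hb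
        obtain ⟨w, hw, rfl⟩ := hb
        exact ⟨hCK _ w.2, hw⟩)
    rw [Finset.card_map, SimpleGraph.card_neighborFinset_eq_degree] at this
    omega
  have hcomp : ∀ u, Fᶜ.degree u + F.degree u = t + 1 := by
    intro u
    rw [SimpleGraph.degree_compl, hcard]
    have := hFdeg u
    omega
  have her := er_bound Fᶜ (fun u => by have := hcomp u; have := hFdeg u; omega)
    (by
      intro u v huv hn
      have hadj : G.Adj u v := by
        by_contra h
        exact hn (by rw [SimpleGraph.compl_adj]; exact ⟨huv, h⟩)
      by_contra hcon
      push Not at hcon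
      apply hG
      refine star_minor hs G K hK hdom {u.1, v.1} (SimpleGraph.induce_pair_connected_of_adj hadj)
        ?_ (C \ {u.1, v.1}) ?_ ?_ ?_ ?_
      · intro w hw
        rcases hw with rfl | hw
        · exact hCK _ u.2
        · rw [Set.mem_singleton_iff] at hw
          rw [hw]; exact hCK _ v.2
      · have h1 := Finset.le_card_sdiff {u.1, v.1} C
        have h2 := Finset.card_le_two (a := u.1) (b := v.1)
        omega
      · intro b hb
        exact hCK _ (Finset.mem_sdiff.1 hb).1
      · intro b hb
        have := (Finset.mem_sdiff.1 hb).2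
        simpa using this
      · intro b hb
        obtain ⟨hbC, hb2⟩ := Finset.mem_sdiff.1 hb
        simp only [Finset.mem_insert, Finset.mem_singleton, not_or] at hb2
        by_cases hub : G.Adj u b
        · exact ⟨u, by simp, hub⟩
        · refine ⟨v, by simp, ?_⟩
          by_contra hvb
          refine hcon ⟨b, hbC⟩ ?_ ?_
          · rw [SimpleGraph.compl_adj]
            exact ⟨fun h => hb2.1 (congrArg Subtype.val h).symm, hub⟩
          · rw [SimpleGraph.compl_adj]
            exact ⟨fun h => hb2.2 (congrArg Subtype.val h).symm, hvb⟩)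
    (by
      intro v
      obtain ⟨w, hw, hvw⟩ := hiso v v.2
      refine ⟨⟨w, hw⟩, fun h => hvw.ne (congrArg Subtype.val h).symm, ?_⟩
      rw [SimpleGraph.compl_adj]
      exact fun h => h.2 hvw)
  have hsum : ∑ u, Fᶜ.degree u + ∑ u, F.degree u = (t + 2) * (t + 1) := by
    rw [← Finset.sum_add_distrib, Finset.sum_congr rfl (fun u _ => hcomp u)]
    simp [hC]
  have hee : ∑ u, F.degree u = ee G C C := by
    rw [← ee_univ]
    unfold ee
    rw [← Finset.sum_coe_sort C]
    refine Finset.sum_congr rfl fun u _ => ?_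
    rw [← Finset.sum_coe_sort C]
    exact Finset.sum_congr rfl fun w _ => by simp only [hF]
  rw [hcard] at her
  rw [hee] at hsum
  nlinarith

lemma arith_small {t m1 m2 e1 e2 : ℕ} (ht : 4 ≤ t) (h1 : 1 ≤ m1 ∧ m1 ≤ t - 1 ∧ e1 + m1 ≤ m1 * m1)
    (h2 : m2 = t + 2 ∧ e2 + t ≤ t * t + 4) :
    ∃ a b c, a ≤ t ∧ b ≤ t ∧ c ≤ t ∧ a + b + c = m1 + m2 ∧
      e1 + e2 + (a + b + c) < a * a + b * b + c * c := by
  obtain ⟨h1, h1', h1''⟩ := h1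
  obtain ⟨rfl, h2⟩ := h2
  by_cases h : m1 + 2 ≤ t
  · exact ⟨t, m1 + 2, 0, le_rfl, h, by omega, by omega, by nlinarith⟩
  · have : t = m1 + 1 := by omega
    subst this
    exact ⟨m1 + 1, m1 + 1, 1, le_rfl, le_rfl, by omega, by omega, by nlinarith⟩

lemma arith {t m1 m2 e1 e2 : ℕ} (ht : 4 ≤ t)
    (h1 : (1 ≤ m1 ∧ m1 ≤ t - 1 ∧ e1 + m1 ≤ m1 * m1) ∨ (m1 = t + 2 ∧ e1 + t ≤ t * t + 4))
    (h2 : (1 ≤ m2 ∧ m2 ≤ t - 1 ∧ e2 + m2 ≤ m2 * m2) ∨ (m2 = t + 2 ∧ e2 + t ≤ t * t + 4)) :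
    ∃ a b c, a ≤ t ∧ b ≤ t ∧ c ≤ t ∧ a + b + c = m1 + m2 ∧
      e1 + e2 + (a + b + c) < a * a + b * b + c * c := by
  rcases h1 with h1 | h1 <;> rcases h2 with h2 | h2
  · obtain ⟨h1, h1', h1''⟩ := h1
    obtain ⟨h2, h2', h2''⟩ := h2
    by_cases h : m1 + m2 ≤ t
    · exact ⟨m1 + m2, 0, 0, h, by omega, by omega, by omega, by nlinarith⟩
    · obtain ⟨b, hb⟩ : ∃ b, m1 + m2 = t + b := ⟨m1 + m2 - t, by omega⟩
      obtain ⟨i, hi⟩ : ∃ i, t = m1 + (i + 1) := ⟨t - m1 - 1, by omega⟩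
      have hm2 : m2 = b + (i + 1) := by omega
      have hbm : b + 1 ≤ m1 := by omega
      refine ⟨t, b, 0, le_rfl, by omega, by omega, by omega, ?_⟩
      subst hm2
      rw [hi]
      nlinarith [Nat.mul_le_mul_right (i + 1) hbm]
  · exact arith_small ht h1 h2
  · obtain ⟨a, b, c, ha, hb, hc, h, h'⟩ := arith_small ht h2 h1
    exact ⟨a, b, c, ha, hb, hc, by omega, by omega⟩
  · obtain ⟨rfl, h1⟩ := h1
    obtain ⟨rfl, h2⟩ := h2
    exact ⟨t, t, 4, le_rfl, le_rfl, ht, by omega, by nlinarith⟩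

set_option maxHeartbeats 2000000 in
/-- The core contradiction, phrased with finsets `C1`, `C2` closed under adjacency outside `K`. -/
lemma core {s t n : ℕ} (ht : 4 ≤ t) (hs : 2 ≤ s) (hst : s ≤ t)
    (hn : (2 * ((2 * t + 4) * (2 * t + 4) + 1) * t) ^ 2 + s ≤ n)
    (G : SimpleGraph (Fin n)) (K : Finset (Fin n))
    (hG : ¬ MinorOf (completeBipartiteGraph (Fin s) (Fin t)) G)
    (hmax : ∀ G' : SimpleGraph (Fin n),
        ¬ MinorOf (completeBipartiteGraph (Fin s) (Fin t)) G' → specRad G' ≤ specRad G)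
    (hK : K.card = s - 1) (hcl : G.IsClique (↑K : Set (Fin n)))
    (hdom : ∀ v : Fin n, v ∉ K → ∀ u ∈ K, G.Adj u v)
    (C1 C2 : Finset (Fin n)) (hdisj : Disjoint C1 C2)
    (hCK1 : ∀ v ∈ C1, v ∉ K) (hCK2 : ∀ v ∈ C2, v ∉ K)
    (hcl1 : ∀ u ∈ C1, ∀ v, v ∉ K → G.Adj u v → v ∈ C1)
    (hcl2 : ∀ u ∈ C2, ∀ v, v ∉ K → G.Adj u v → v ∈ C2)
    (hiso1 : 2 ≤ C1.card → ∀ u ∈ C1, ∃ w ∈ C1, G.Adj u w)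
    (hiso2 : 2 ≤ C2.card → ∀ u ∈ C2, ∃ w ∈ C2, G.Adj u w)
    (hc1 : (1 ≤ C1.card ∧ C1.card ≤ t - 1) ∨ C1.card = t + 2)
    (hc2 : (1 ≤ C2.card ∧ C2.card ≤ t - 1) ∨ C2.card = t + 2) : False := by
  classical
  have hb : ∀ C : Finset (Fin n), (∀ v ∈ C, v ∉ K) → (2 ≤ C.card → ∀ u ∈ C, ∃ w ∈ C, G.Adj u w) →
      ((1 ≤ C.card ∧ C.card ≤ t - 1) ∨ C.card = t + 2) →
      (1 ≤ C.card ∧ C.card ≤ t - 1 ∧ ee G C C + C.card ≤ C.card * C.card) ∨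
        (C.card = t + 2 ∧ ee G C C + t ≤ t * t + 4) := by
    intro C hCK hiso hc
    rcases hc with hc | hc
    · exact Or.inl ⟨hc.1, hc.2, ee_le_clique G C⟩
    · exact Or.inr ⟨hc, comp_bound (by omega) G K hG hK hdom C hCK hc (hiso (by omega))⟩
  obtain ⟨a, b, c, ha, hb', hc, habc, hlt⟩ :=
    arith ht (hb C1 hCK1 hiso1 hc1) (hb C2 hCK2 hiso2 hc2)
  set S := C1 ∪ C2 with hS
  have hScard : S.card = C1.card + C2.card := Finset.card_union_of_disjoint hdisj
  have hSK : ∀ v ∈ S, v ∉ K := by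
    intro v hv
    rcases Finset.mem_union.1 hv with h | h
    · exact hCK1 v h
    · exact hCK2 v h
  have hcross : ∀ u ∈ S, ∀ v, v ∉ S → v ∉ K → ¬ G.Adj u v := by
    intro u hu v hv hvK huv
    rcases Finset.mem_union.1 hu with h | h
    · exact hv (Finset.mem_union_left _ (hcl1 u h v hvK huv))
    · exact hv (Finset.mem_union_right _ (hcl2 u h v hvK huv))
  have h12 : ee G C1 C2 = 0 := by
    unfold ee
    refine Finset.sum_eq_zero fun u hu => Finset.sum_eq_zero fun v hv => if_neg fun h => ?_
    exact Finset.disjoint_left.1 hdisj (hcl1 u hu v (hCK2 v hv) h) hv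
  have hSS : ee G S S = ee G C1 C1 + ee G C2 C2 := by
    rw [hS, ee_union_right G _ _ _ hdisj, ee_union_left G _ _ _ hdisj, ee_union_left G _ _ _ hdisj,
      ee_comm G C2 C1, h12]
    omega
  obtain ⟨A, hAS, hA⟩ := Finset.exists_subset_card_eq (s := S) (n := a) (by omega)
  obtain ⟨B, hBS, hB⟩ := Finset.exists_subset_card_eq (s := S \ A) (n := b) (by
    rw [Finset.card_sdiff_of_subset hAS]; omega)
  set D := (S \ A) \ B with hD
  have hDcard : D.card = c := by
    rw [hD, Finset.card_sdiff_of_subset hBS, Finset.card_sdiff_of_subset hAS]; omega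
  let f : Fin n → Fin 3 := fun v => if v ∈ A then 0 else if v ∈ B then 1 else 2
  have hAB : ∀ v ∈ B, v ∈ S ∧ v ∉ A := fun v hv => Finset.mem_sdiff.1 (hBS hv)
  have hDm : ∀ v, v ∈ D ↔ (v ∈ S ∧ v ∉ A) ∧ v ∉ B := by
    intro v; rw [hD, Finset.mem_sdiff, Finset.mem_sdiff]
  have hfA : ∀ v ∈ A, f v = 0 := fun v hv => by simp [f, hv]
  have hfB : ∀ v ∈ B, f v = 1 := fun v hv => by simp [f, hv, (hAB v hv).2]
  have hfD : ∀ v ∈ D, f v = 2 := fun v hv => by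
    have := (hDm v).1 hv
    simp [f, this.1.2, this.2]
  obtain ⟨G', hG'def⟩ : ∃ G' : SimpleGraph (Fin n), ∀ u v, G'.Adj u v ↔
      (u ∈ S ∧ v ∈ S ∧ u ≠ v ∧ f u = f v) ∨ (¬ (u ∈ S ∧ v ∈ S) ∧ G.Adj u v) := ⟨
    { Adj := fun u v => (u ∈ S ∧ v ∈ S ∧ u ≠ v ∧ f u = f v) ∨ (¬ (u ∈ S ∧ v ∈ S) ∧ G.Adj u v)
      symm := ⟨fun u v h => by
        rcases h with h | h
        · exact Or.inl ⟨h.2.1, h.1, h.2.2.1.symm, h.2.2.2.symm⟩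
        · exact Or.inr ⟨fun hh => h.1 hh.symm, h.2.symm⟩⟩
      loopless := ⟨fun u h => by
        rcases h with h | h
        · exact h.2.2.1 rfl
        · exact h.2.ne rfl⟩ }, fun u v => Iff.rfl⟩
  have hGG : ∀ u v, ¬ (u ∈ S ∧ v ∈ S) → (G'.Adj u v ↔ G.Adj u v) := by
    intro u v h
    rw [hG'def]
    exact ⟨fun h' => h'.elim (fun h'' => absurd ⟨h''.1, h''.2.1⟩ h) (fun h'' => h''.2),
      fun h' => Or.inr ⟨h, h'⟩⟩
  have hfcard : ∀ i, (S.filter (fun v => f v = i)).card ≤ t := by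
    intro i
    have key : ∀ X : Finset (Fin n), X.card ≤ t → (∀ v ∈ S, f v = i → v ∈ X) →
        (S.filter (fun v => f v = i)).card ≤ t := by
      intro X hX h
      refine le_trans (Finset.card_le_card fun v hv => ?_) hX
      rw [Finset.mem_filter] at hv
      exact h v hv.1 hv.2
    have htri : ∀ v ∈ S, v ∈ A ∨ v ∈ B ∨ v ∈ D := by
      intro v hv
      rw [hDm]; tauto
    fin_cases i
    · refine key A (by omega) fun v hv h => ?_
      rcases htri v hv with h' | h' | h'
      · exact h'
      · rw [hfB v h'] at h; simp at h
      · rw [hfD v h'] at h; simp at h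
    · refine key B (by omega) fun v hv h => ?_
      rcases htri v hv with h' | h' | h'
      · rw [hfA v h'] at h; simp at h
      · exact h'
      · rw [hfD v h'] at h; simp at h
    · refine key D (by omega) fun v hv h => ?_
      rcases htri v hv with h' | h' | h'
      · rw [hfA v h'] at h; simp at h
      · rw [hfB v h'] at h; simp at h
      · exact h'
  have hG'm := minor_transfer (by omega) hst G G' K S f hK hcl hdom hcross hGG
    (by
      intro u hu v hv h
      rw [hG'def] at h
      rcases h with h | h
      · exact h.2.2.2
      · exact absurd ⟨hu, hv⟩ h.1) hfcard hG
  have hbig : ((S ×ˢ S).filter (fun p => G.Adj p.1 p.2)).card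
      < ((S ×ˢ S).filter (fun p => G'.Adj p.1 p.2)).card := by
    have h1 : (A.offDiag ∪ B.offDiag) ∪ D.offDiag ⊆
        (S ×ˢ S).filter (fun p => G'.Adj p.1 p.2) := by
      intro p hp
      simp only [Finset.mem_union, Finset.mem_offDiag] at hp
      simp only [Finset.mem_filter, Finset.mem_product, hG'def]
      rcases hp with (⟨h1, h2, h3⟩ | ⟨h1, h2, h3⟩) | ⟨h1, h2, h3⟩
      · have h1' := hAS h1
        have h2' := hAS h2
        exact ⟨⟨h1', h2'⟩, Or.inl ⟨h1', h2', h3, by rw [hfA _ h1, hfA _ h2]⟩⟩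
      · have h1' := (hAB _ h1).1
        have h2' := (hAB _ h2).1
        exact ⟨⟨h1', h2'⟩, Or.inl ⟨h1', h2', h3, by rw [hfB _ h1, hfB _ h2]⟩⟩
      · have h1' := ((hDm _).1 h1).1.1
        have h2' := ((hDm _).1 h2).1.1
        exact ⟨⟨h1', h2'⟩, Or.inl ⟨h1', h2', h3, by rw [hfD _ h1, hfD _ h2]⟩⟩
    have h2 := Finset.card_le_card h1
    have hd1 : Disjoint A.offDiag B.offDiag := by
      rw [Finset.disjoint_left]
      intro p hp hq
      rw [Finset.mem_offDiag] at hp hq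
      exact (hAB _ hq.1).2 hp.1
    have hd2 : Disjoint (A.offDiag ∪ B.offDiag) D.offDiag := by
      rw [Finset.disjoint_left]
      intro p hp hq
      rw [Finset.mem_union, Finset.mem_offDiag, Finset.mem_offDiag] at hp
      rw [Finset.mem_offDiag] at hq
      have := (hDm _).1 hq.1
      rcases hp with hp | hp
      · exact this.1.2 hp.1
      · exact this.2 hp.1
    rw [Finset.card_union_of_disjoint hd2, Finset.card_union_of_disjoint hd1, Finset.offDiag_card,
      Finset.offDiag_card, Finset.offDiag_card, hA, hB, hDcard] at h2
    have := Nat.le_mul_self a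
    have := Nat.le_mul_self b
    have := Nat.le_mul_self c
    rw [card_pairs_eq_ee G, hSS]
    omega
  have hPle : ((S ×ˢ S).filter (fun p => G.Adj p.1 p.2)).card ≤ (2 * t + 4) * (2 * t + 4) := by
    refine (Finset.card_filter_le _ _).trans ?_
    rw [Finset.card_product]
    have : S.card ≤ 2 * t + 4 := by omega
    exact Nat.mul_le_mul this this
  have hspec := spec_increase hs (by omega : 1 ≤ t) hn G G' K S hK hcl hdom hSK
    (fun v hv => (deg_bound (by omega) G K hG hK hdom v hv _ (by
      intro b hb
      simpa using hb)).le) hGG hPle hbig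
  exact absurd (hmax G' hG'm) (not_le.2 hspec)

/-- Lemma 4.1: at most one component of G⋆ − K has order in {1,…,t−1} ∪ {t+2}. -/
theorem at_most_one_small_or_tplus2_component (s t : ℕ) (ht : 4 ≤ t) (hs : 2 ≤ s) (hst : s ≤ t) :
    ∃ n₀ : ℕ, ∀ n : ℕ, n₀ ≤ n →
    ∀ (G : SimpleGraph (Fin n)) (K : Finset (Fin n)),
      ¬ MinorOf (completeBipartiteGraph (Fin s) (Fin t)) G →
      (∀ G' : SimpleGraph (Fin n),
        ¬ MinorOf (completeBipartiteGraph (Fin s) (Fin t)) G' → specRad G' ≤ specRad G) →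
      K.card = s - 1 → G.IsClique (↑K : Set (Fin n)) →
      (∀ v : Fin n, v ∉ K → ∀ u ∈ K, G.Adj u v) →
      {c : (G.comap (Subtype.val : {v : Fin n // v ∉ K} → Fin n)).ConnectedComponent |
        (1 ≤ c.supp.ncard ∧ c.supp.ncard ≤ t - 1) ∨ c.supp.ncard = t + 2}.ncard ≤ 1 := by
  refine ⟨(2 * ((2 * t + 4) * (2 * t + 4) + 1) * t) ^ 2 + s, ?_⟩
  intro n hn G K hG hmax hK hcl hdom
  classical
  set L := G.comap (Subtype.val : {v : Fin n // v ∉ K} → Fin n) with hL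
  by_contra hcon
  push Not at hcon
  obtain ⟨c1, hc1, c2, hc2, hne⟩ := (Set.one_lt_ncard (Set.toFinite _)).1 hcon
  simp only [Set.mem_ofPred_eq] at hc1 hc2
  let C : L.ConnectedComponent → Finset (Fin n) := fun c =>
    c.supp.toFinset.map (Function.Embedding.subtype _)
  have hCm : ∀ c v, v ∈ C c ↔ ∃ h : v ∉ K, L.connectedComponentMk ⟨v, h⟩ = c := by
    intro c v
    simp [C]
  have hCcard : ∀ c, (C c).card = c.supp.ncard := by
    intro c
    rw [Finset.card_map, Set.ncard_eq_toFinset_card']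
  have hCK : ∀ c, ∀ v ∈ C c, v ∉ K := fun c v hv => ((hCm c v).1 hv).1
  have hclosed : ∀ c, ∀ u ∈ C c, ∀ v, v ∉ K → G.Adj u v → v ∈ C c := by
    intro c u hu v hv huv
    obtain ⟨hu', rfl⟩ := (hCm c u).1 hu
    refine (hCm _ v).2 ⟨hv, ?_⟩
    have hadj : L.Adj ⟨u, hu'⟩ ⟨v, hv⟩ := huv
    exact SimpleGraph.ConnectedComponent.sound hadj.reachable.symm
  have hiso : ∀ c, 2 ≤ (C c).card → ∀ u ∈ C c, ∃ w ∈ C c, G.Adj u w := by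
    intro c h2 u hu
    obtain ⟨w, hw, hwu⟩ := Finset.exists_mem_ne (by omega : 1 < (C c).card) u
    obtain ⟨hu', hu2⟩ := (hCm c u).1 hu
    obtain ⟨hw', hw2⟩ := (hCm c w).1 hw
    have hr : L.Reachable ⟨u, hu'⟩ ⟨w, hw'⟩ :=
      SimpleGraph.ConnectedComponent.exact (hu2.trans hw2.symm)
    obtain ⟨p⟩ := hr
    cases p with
    | nil => exact absurd rfl hwu
    | @cons _ z _ h q =>
      have h' : G.Adj u z.1 := h
      exact ⟨z.1, hclosed c u hu z.1 z.2 h', h'⟩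
  refine core ht hs hst hn G K hG hmax hK hcl hdom (C c1) (C c2) ?_ (hCK c1) (hCK c2)
    (hclosed c1) (hclosed c2) (hiso c1) (hiso c2) ?_ ?_
  · rw [Finset.disjoint_left]
    intro v h1 h2
    obtain ⟨h, h1⟩ := (hCm c1 v).1 h1
    obtain ⟨h', h2⟩ := (hCm c2 v).1 h2
    exact hne (h1.symm.trans h2)
  · rw [hCcard]; exact hc1
  · rw [hCcard]; exact hc2
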